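/- Let A be an algebra with Day operations m₀,…,m_n, let k ≥ 2, α₀,…,α_{k-1} ∈ Con(A), and let σ be any permutation of {0,…,k-1}. Then [α₀,…,α_{k-1}] = [α_{σ(0)},…,α_{σ(k-1)}] (symmetry of the higher commutator). -/

import Mathlib

namespace UACommutator

/-- A signature: a type of operation symbols with arities. -/
structure Signature where
  ops : Type
  arity : ops → ℕ

/-- An algebra for a signature: a nonempty carrier with interpretations of the operations. -/
structure Alg (σ : Signature) where
  carrier : Type
  nonempty : Nonempty carrier
  interp : (o : σ.ops) → (Fin (σ.arity o) → carrier) → carrier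

/-- A congruence of an algebra: an equivalence relation compatible with all basic operations. -/
structure Congruence {σ : Signature} (A : Alg σ) where
  rel : A.carrier → A.carrier → Prop
  iseqv : Equivalence rel
  compat : ∀ (o : σ.ops) (x y : Fin (σ.arity o) → A.carrier),
    (∀ i, rel (x i) (y i)) → rel (A.interp o x) (A.interp o y)

instance {σ : Signature} {A : Alg σ} : LE (Congruence A) :=
  ⟨fun a b => ∀ x y, a.rel x y → b.rel x y⟩

/-- Terms of the signature with variables in `V`. -/
inductive Term (σ : Signature) (V : Type) : Type
  | var : V → Term σ V
  | app : (o : σ.ops) → (Fin (σ.arity o) → Term σ V) → Term σ V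

def Term.evalA {σ : Signature} (A : Alg σ) {V : Type} :
    Term σ V → (V → A.carrier) → A.carrier
  | .var v, env => env v
  | .app o args, env => A.interp o (fun i => (args i).evalA A env)

/-- Polynomial operations of an algebra `A` with variables in `V`:
built from variables, constants of `A`, and the basic operations. -/
inductive Poly {σ : Signature} (A : Alg σ) (V : Type) : Type
  | var : V → Poly A V
  | const : A.carrier → Poly A V
  | app : (o : σ.ops) → (Fin (σ.arity o) → Poly A V) → Poly A V

def Poly.eval {σ : Signature} {A : Alg σ} {V : Type} :
    Poly A V → (V → A.carrier) → A.carrier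
  | .var v, env => env v
  | .const c, _ => c
  | .app o args, env => A.interp o (fun i => (args i).eval env)

/-- Evaluate a polynomial whose variables are grouped into `k` tuples (tuple `i` of
length `ν i`) at the tuples `a i` (where `g i = false`) or `b i` (where `g i = true`). -/
def evalTup {σ : Signature} {A : Alg σ} {k : ℕ} {ν : Fin k → ℕ}
    (p : Poly A (Σ i, Fin (ν i))) (a b : ∀ i, Fin (ν i) → A.carrier)
    (g : Fin k → Bool) : A.carrier :=
  p.eval (fun x => if g x.1 then b x.1 x.2 else a x.1 x.2)

/-- The term condition `C(α₀,…,α_{k-1}; δ)`, centralizing at coordinate `j`. -/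
def TC {σ : Signature} {A : Alg σ} {k : ℕ} (α : Fin k → Congruence A) (j : Fin k)
    (δ : Congruence A) : Prop :=
  ∀ (ν : Fin k → ℕ) (p : Poly A (Σ i, Fin (ν i)))
    (a b : ∀ i, Fin (ν i) → A.carrier),
    (∀ i mm, (α i).rel (a i mm) (b i mm)) →
    (∀ g : Fin k → Bool, g j = false → (∃ i, i ≠ j ∧ g i = false) →
      δ.rel (evalTup p a b g) (evalTup p a b (Function.update g j true))) →
    δ.rel (evalTup p a b (Function.update (fun _ => true) j false))
          (evalTup p a b (fun _ => true))

/-- The meet (intersection) of a family of congruences. -/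
def infCong {σ : Signature} {A : Alg σ} {ι : Sort*} (ds : ι → Congruence A) :
    Congruence A where
  rel x y := ∀ i, (ds i).rel x y
  iseqv := ⟨fun x i => (ds i).iseqv.refl x,
            fun h i => (ds i).iseqv.symm (h i),
            fun h h' i => (ds i).iseqv.trans (h i) (h' i)⟩
  compat o x y h := fun i => (ds i).compat o x y (fun mm => h mm i)

/-- The higher commutator `[α₀,…,α_{k-1}]` (term-condition version), as the meet of
all congruences `δ` such that `C(α₀,…,α_{k-1}; δ)` holds, centralizing at `j`. -/
def commTC {σ : Signature} {A : Alg σ} {k : ℕ} (α : Fin k → Congruence A) (j : Fin k) :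
    Congruence A :=
  infCong (fun d : {δ : Congruence A // TC α j δ} => d.val)

/-- The congruence generated by a binary relation `X`. -/
def Cg {σ : Signature} {A : Alg σ} (X : A.carrier → A.carrier → Prop) : Congruence A :=
  infCong (fun d : {δ : Congruence A // ∀ x y, X x y → δ.rel x y} => d.val)

theorem Cg_base {σ : Signature} {A : Alg σ} (X : A.carrier → A.carrier → Prop)
    {x y : A.carrier} (h : X x y) : (Cg X).rel x y :=
  fun i => i.2 x y h

/-- The join of a family of congruences: the least congruence containing every member. -/
def supCong {σ : Signature} {A : Alg σ} {ι : Sort*} (γ : ι → Congruence A) :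
    Congruence A :=
  Cg (fun x y => ∃ i, (γ i).rel x y)

/-- The join of two congruences. -/
def joinCong {σ : Signature} {A : Alg σ} (a b : Congruence A) : Congruence A :=
  Cg (fun x y => a.rel x y ∨ b.rel x y)

/-- `m` is a `T`-matrix for `T = (θ₀,…,θ_{k-1})`. -/
def IsMatrix {σ : Signature} {A : Alg σ} {k : ℕ} (θ : Fin k → Congruence A)
    (m : (Fin k → Bool) → A.carrier) : Prop :=
  ∃ (ν : Fin k → ℕ) (p : Poly A (Σ i, Fin (ν i))) (a b : ∀ i, Fin (ν i) → A.carrier),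
    (∀ i jj, (θ i).rel (a i jj) (b i jj)) ∧
    ∀ f : Fin k → Bool, m f = evalTup p a b f

/-- The matrix centralization condition `C(T; j; δ)`: for every `T`-matrix, if every
`(j)`-supporting line is a `δ`-pair then the `(j)`-pivot line is a `δ`-pair. -/
def CMat {σ : Signature} {A : Alg σ} {k : ℕ} (θ : Fin k → Congruence A) (j : Fin k)
    (δ : Congruence A) : Prop :=
  ∀ m : (Fin k → Bool) → A.carrier, IsMatrix θ m →
    (∀ g : Fin k → Bool, (∃ i, i ≠ j ∧ g i = false) →
      δ.rel (m (Function.update g j false)) (m (Function.update g j true))) →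
    δ.rel (m (Function.update (fun _ => true) j false)) (m (fun _ => true))

/-- `[T]_j`: the meet of all congruences `δ` with `C(T; j; δ)`. -/
def commMat {σ : Signature} {A : Alg σ} {k : ℕ} (θ : Fin k → Congruence A) (j : Fin k) :
    Congruence A :=
  infCong (fun d : {δ : Congruence A // CMat θ j δ} => d.val)

/-- Day operations `m₀, …, m_n` for an algebra, each induced by a term of the signature. -/
structure DayOps {σ : Signature} (A : Alg σ) (n : ℕ) where
  m : Fin (n+1) → A.carrier → A.carrier → A.carrier → A.carrier → A.carrier
  isTerm : ∀ e, ∃ t : Term σ (Fin 4), ∀ x y z u, m e x y z u = t.evalA A ![x, y, z, u]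
  idem : ∀ e x y, m e x y y x = x
  first : ∀ x y z u, m 0 x y z u = x
  last : ∀ x y z u, m (Fin.last n) x y z u = u
  even : ∀ (e : ℕ) (he : e < n), Even e → ∀ x u,
    m ⟨e, by omega⟩ x x u u = m ⟨e+1, by omega⟩ x x u u
  odd : ∀ (e : ℕ) (he : e < n), Odd e → ∀ x y u,
    m ⟨e, by omega⟩ x y y u = m ⟨e+1, by omega⟩ x y y u

/-- The `e`-th shift rotation at `(j, l)` of a cube `h`. -/
def shiftRot {σ : Signature} {A : Alg σ} {n k : ℕ} (D : DayOps A n) (e : Fin (n+1))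
    (j l : Fin k) (h : (Fin k → Bool) → A.carrier) :
    (Fin k → Bool) → A.carrier := fun f =>
  let r := h (Function.update (Function.update f j false) l false)
  let s := h (Function.update (Function.update f j false) l true)
  let u := h (Function.update (Function.update f j true) l false)
  let v := h (Function.update (Function.update f j true) l true)
  if f j then (if f l then D.m e s s v v else D.m e s r u v) else s

/-- `hIter D m hm d h` is `h^{(d₀,…,d_{m-1})}`: the result of applying the shift
rotations `R^{d₀}_{0,1}, …, R^{d_{m-1}}_{m-1,m}` successively to `h`. -/
def hIter {σ : Signature} {A : Alg σ} {n k : ℕ} (D : DayOps A n) :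
    (m : ℕ) → m < k → (Fin m → Fin (n+1)) → ((Fin k → Bool) → A.carrier) →
    ((Fin k → Bool) → A.carrier)
  | 0, _, _, h => h
  | (m+1), hm, d, h =>
      shiftRot D (d (Fin.last m)) ⟨m, by omega⟩ ⟨m+1, hm⟩
        (hIter D m (by omega) (fun i => d i.castSucc) h)

/-- `X(T)`: the set of `(k-1)`-pivot lines of the matrices `h^d`, over all `T`-matrices
`h` and all `d ∈ {0,…,n}^{k-1}`. -/
def XSet {σ : Signature} {A : Alg σ} {n k : ℕ} (hk : 0 < k) (D : DayOps A n)
    (θ : Fin k → Congruence A) : A.carrier → A.carrier → Prop :=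
  fun x y => ∃ h : (Fin k → Bool) → A.carrier, IsMatrix θ h ∧
    ∃ d : Fin (k-1) → Fin (n+1),
      x = hIter D (k-1) (by omega) d h
            (Function.update (fun _ => true) (⟨k-1, by omega⟩ : Fin k) false) ∧
      y = hIter D (k-1) (by omega) d h (fun _ => true)

/-- Product algebra `A^I` with pointwise operations. -/
def prodAlg {σ : Signature} (A : Alg σ) (I : Type) : Alg σ where
  carrier := I → A.carrier
  nonempty := ⟨fun _ => Classical.choice A.nonempty⟩
  interp o x := fun i => A.interp o (fun mm => x mm i)

/-- Membership in the subalgebra of `B` generated by a set `S`. -/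
inductive Gen {σ : Signature} (B : Alg σ) (S : Set B.carrier) : B.carrier → Prop
  | base : ∀ x ∈ S, Gen B S x
  | app : ∀ (o : σ.ops) (x : Fin (σ.arity o) → B.carrier),
      (∀ i, Gen B S (x i)) → Gen B S (B.interp o x)

/-- `f : A → B` is a homomorphism. -/
def IsHom {σ : Signature} (A B : Alg σ) (f : A.carrier → B.carrier) : Prop :=
  ∀ (o : σ.ops) (x : Fin (σ.arity o) → A.carrier),
    f (A.interp o x) = B.interp o (fun i => f (x i))

/-- The kernel congruence of a homomorphism. -/
def kerCong {σ : Signature} {A B : Alg σ} (f : A.carrier → B.carrier)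
    (hf : IsHom A B f) : Congruence A where
  rel x y := f x = f y
  iseqv := ⟨fun _ => rfl, Eq.symm, Eq.trans⟩
  compat o x y h := by
    show f (A.interp o x) = f (A.interp o y)
    rw [hf o x, hf o y]
    congr 1
    funext i
    exact h i

/-- The image `f(γ)` of a congruence `γ ≥ ker f` under a surjective homomorphism `f`. -/
def mapCong {σ : Signature} {A B : Alg σ} (f : A.carrier → B.carrier)
    (hf : IsHom A B f) (hs : Function.Surjective f) (γ : Congruence A)
    (hγ : ∀ x y, f x = f y → γ.rel x y) : Congruence B where
  rel u v := ∃ x y, γ.rel x y ∧ f x = u ∧ f y = v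
  iseqv := by
    refine ⟨?_, ?_, ?_⟩
    · intro u
      obtain ⟨x, hx⟩ := hs u
      exact ⟨x, x, γ.iseqv.refl x, hx, hx⟩
    · rintro u v ⟨x, y, hxy, hx, hy⟩
      exact ⟨y, x, γ.iseqv.symm hxy, hy, hx⟩
    · rintro u v w ⟨x, y, hxy, hx, hy⟩ ⟨y', z, hyz, hy', hz⟩
      exact ⟨x, z, γ.iseqv.trans hxy (γ.iseqv.trans (hγ y y' (hy.trans hy'.symm)) hyz),
        hx, hz⟩
  compat o u v h := by
    choose x y hxy hx hy using h
    refine ⟨A.interp o x, A.interp o y, γ.compat o x y hxy, ?_, ?_⟩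
    · rw [hf o x]
      congr 1
      funext i
      exact hx i
    · rw [hf o y]
      congr 1
      funext i
      exact hy i

/-- The preimage `f⁻¹(β)` of a congruence of `B` under a homomorphism `f`. -/
def comapCong {σ : Signature} {A B : Alg σ} (f : A.carrier → B.carrier)
    (hf : IsHom A B f) (β : Congruence B) : Congruence A where
  rel x y := β.rel (f x) (f y)
  iseqv := ⟨fun _ => β.iseqv.refl _, β.iseqv.symm, β.iseqv.trans⟩
  compat o x y h := by
    show β.rel (f (A.interp o x)) (f (A.interp o y))
    rw [hf o x, hf o y]
    exact β.compat o _ _ h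

/-- Substitute polynomials for the variables of a polynomial. -/
def Poly.subst {σ : Signature} {A : Alg σ} {V W : Type} (f : V → Poly A W) :
    Poly A V → Poly A W
  | .var v => f v
  | .const c => .const c
  | .app o args => .app o (fun i => (args i).subst f)

theorem Poly.eval_subst {σ : Signature} {A : Alg σ} {V W : Type} (f : V → Poly A W)
    (p : Poly A V) (env : W → A.carrier) :
    (p.subst f).eval env = p.eval (fun v => (f v).eval env) := by
  induction p with
  | var v => rfl
  | const c => rfl
  | app o args ih => simp only [Poly.subst, Poly.eval, ih]

/-- Substitute polynomials for the variables of a term. -/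
def Term.substPoly {σ : Signature} {A : Alg σ} {V W : Type} (f : V → Poly A W) :
    Term σ V → Poly A W
  | .var v => f v
  | .app o args => .app o (fun i => (args i).substPoly f)

theorem Term.eval_substPoly {σ : Signature} {A : Alg σ} {V W : Type} (f : V → Poly A W)
    (t : Term σ V) (env : W → A.carrier) :
    (t.substPoly f).eval env = t.evalA A (fun v => (f v).eval env) := by
  induction t with
  | var v => rfl
  | app o args ih => simp only [Term.substPoly, Poly.eval, Term.evalA, ih]

theorem Congruence.rel_evalA {σ : Signature} {A : Alg σ} (δ : Congruence A) {V : Type}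
    (t : Term σ V) {x y : V → A.carrier} (h : ∀ v, δ.rel (x v) (y v)) :
    δ.rel (t.evalA A x) (t.evalA A y) := by
  induction t with
  | var v => exact h v
  | app o args ih => exact δ.compat o _ _ ih

theorem DayOps.rel_m {σ : Signature} {A : Alg σ} {n : ℕ} (D : DayOps A n)
    (δ : Congruence A) (e : Fin (n + 1)) {x y z u x' y' z' u' : A.carrier}
    (hx : δ.rel x x') (hy : δ.rel y y') (hz : δ.rel z z') (hu : δ.rel u u') :
    δ.rel (D.m e x y z u) (D.m e x' y' z' u') := by
  obtain ⟨t, ht⟩ := D.isTerm e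
  rw [ht, ht]
  refine δ.rel_evalA t fun v => ?_
  fin_cases v <;> assumption

theorem DayOps.exists_poly {σ : Signature} {A : Alg σ} {n : ℕ} (D : DayOps A n)
    (e : Fin (n + 1)) {V : Type} (p q r s : Poly A V) :
    ∃ w : Poly A V, ∀ env,
      w.eval env = D.m e (p.eval env) (q.eval env) (r.eval env) (s.eval env) := by
  obtain ⟨t, ht⟩ := D.isTerm e
  refine ⟨t.substPoly ![p, q, r, s], fun env => ?_⟩
  rw [Term.eval_substPoly, ht]
  congr 1
  funext v
  fin_cases v <;> rfl

/-- The part of Day's lemma which recovers `s δ v` from the Day operations. -/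
theorem DayOps.rel_of_forall {σ : Signature} {A : Alg σ} {n : ℕ} (D : DayOps A n)
    (δ : Congruence A) {r s u v : A.carrier} (hru : δ.rel r u)
    (h : ∀ e, δ.rel (D.m e s r u v) (D.m e s s v v)) : δ.rel s v := by
  have key : ∀ (e : ℕ) (he : e < n + 1), δ.rel s (D.m ⟨e, he⟩ s s v v) := by
    intro e
    induction e with
    | zero =>
      intro he
      have h0 : D.m ⟨0, he⟩ s s v v = s := D.first s s v v
      rw [h0]
      exact δ.iseqv.refl s
    | succ e ih =>
      intro he
      have hs := ih (by omega)
      rcases Nat.even_or_odd e with hev | hodd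
      · rwa [D.even e (by omega) hev] at hs
      · have move : ∀ d, δ.rel (D.m d s r u v) (D.m d s r r v) := fun d =>
          D.rel_m δ d (δ.iseqv.refl _) (δ.iseqv.refl _) (δ.iseqv.symm hru) (δ.iseqv.refl _)
        have h1 := δ.iseqv.trans (δ.iseqv.symm (h ⟨e, by omega⟩)) (move _)
        rw [D.odd e (by omega) hodd] at h1
        exact δ.iseqv.trans hs
          (δ.iseqv.trans h1 (δ.iseqv.trans (δ.iseqv.symm (move _)) (h _)))
  have hn := key n (by omega)
  have hl : D.m ⟨n, by omega⟩ s s v v = v := D.last s s v v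
  rwa [hl] at hn

/-- Fixing one group of variables of a polynomial at one of its two tuples. -/
theorem exists_poly_update {σ : Signature} {A : Alg σ} {k : ℕ} {ν : Fin k → ℕ}
    (p : Poly A (Σ i, Fin (ν i))) (a b : ∀ i, Fin (ν i) → A.carrier) (j : Fin k)
    (c : Bool) :
    ∃ q : Poly A (Σ i, Fin (ν i)), ∀ g,
      evalTup q a b g = evalTup p a b (Function.update g j c) := by
  refine ⟨p.subst fun x => if x.1 = j then
    .const (if c then b x.1 x.2 else a x.1 x.2) else .var x, fun g => ?_⟩
  simp only [evalTup, Poly.eval_subst]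
  congr 1
  funext x
  by_cases hx : x.1 = j
  · simp [hx, Poly.eval]
  · simp [hx, Poly.eval]

/-- The shift rotation at `(j, l)` of a cube of polynomial values is again such a cube. -/
theorem DayOps.exists_poly_rotation {σ : Signature} {A : Alg σ} {n : ℕ} (D : DayOps A n)
    (e : Fin (n + 1)) {k : ℕ} {ν : Fin k → ℕ} (p : Poly A (Σ i, Fin (ν i)))
    (a b : ∀ i, Fin (ν i) → A.carrier) (j l : Fin k) :
    ∃ q : Poly A (Σ i, Fin (ν i)), ∀ g, evalTup q a b g =
      D.m e (evalTup p a b (Function.update (Function.update g l true) j false))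
        (evalTup p a b (Function.update g j false)) (evalTup p a b g)
        (evalTup p a b (Function.update g l true)) := by
  obtain ⟨p₁, h₁⟩ := exists_poly_update p a b j false
  obtain ⟨p₂, h₂⟩ := exists_poly_update p a b l true
  obtain ⟨p₃, h₃⟩ := exists_poly_update p₁ a b l true
  obtain ⟨q, hq⟩ := D.exists_poly e p₃ p₁ p p₂
  refine ⟨q, fun g => ?_⟩
  rw [← h₁, ← h₃, ← h₁, ← h₂]
  exact hq _

theorem TC.change_coordinate {σ : Signature} {A : Alg σ} {n : ℕ} (D : DayOps A n)
    {k : ℕ} {α : Fin k → Congruence A} {δ : Congruence A} {l : Fin k}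
    (hl : TC α l δ) (j : Fin k) : TC α j δ := by
  rcases eq_or_ne j l with rfl | hjl
  · exact hl
  intro ν p a b hab H
  have H' : ∀ g : Fin k → Bool, (g j = false ∨ ∃ i, i ≠ j ∧ g i = false) →
      δ.rel (evalTup p a b g) (evalTup p a b (Function.update g j false)) := by
    intro g hg
    cases hgj : g j with
    | false =>
      rw [← hgj, Function.update_eq_self]
      exact δ.iseqv.refl _
    | true =>
      obtain ⟨i, hij, hgi⟩ := hg.resolve_left (by simp [hgj])
      have := H (Function.update g j false) (by simp) ⟨i, hij, by simp [hij, hgi]⟩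
      rw [Function.update_idem, ← hgj, Function.update_eq_self] at this
      exact δ.iseqv.symm this
  refine D.rel_of_forall δ
    (r := evalTup p a b (Function.update (Function.update (fun _ => true) l false) j false))
    (u := evalTup p a b (Function.update (fun _ => true) l false))
    (δ.iseqv.symm (H' _ (Or.inr ⟨l, hjl.symm, by simp⟩))) fun e => ?_
  obtain ⟨q, hq⟩ := D.exists_poly_rotation e p a b j l
  have htrue : Function.update (fun _ : Fin k => true) l true = fun _ => true :=
    Function.update_eq_self l _
  have h := hl ν q a b hab ?_
  · simpa only [hq, Function.update_idem, htrue] using h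
  · intro g _ ⟨i, hil, hgi⟩
    have hg : g j = false ∨ ∃ i, i ≠ j ∧ g i = false := by
      rcases eq_or_ne i j with rfl | hij
      · exact Or.inl hgi
      · exact Or.inr ⟨i, hij, hgi⟩
    have hg' : Function.update g l true j = false ∨
        ∃ i, i ≠ j ∧ Function.update g l true i = false := by
      rcases eq_or_ne i j with rfl | hij
      · exact Or.inl (by simp [hil, hgi])
      · exact Or.inr ⟨i, hij, by simp [hil, hgi]⟩
    have hs := δ.iseqv.refl
      (evalTup p a b (Function.update (Function.update g l true) j false))
    have hr := δ.iseqv.refl (evalTup p a b (Function.update g j false))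
    have h₁ := D.rel_m δ e hs hr (H' g hg) (H' _ hg')
    have h₂ := D.rel_m δ e hs hs (H' _ hg') (H' _ hg')
    rw [D.idem] at h₁ h₂
    simp only [hq, Function.update_idem]
    exact δ.iseqv.trans h₁ (δ.iseqv.symm h₂)

theorem TC.of_comp {σ : Signature} {A : Alg σ} {k : ℕ} {α : Fin k → Congruence A}
    {δ : Congruence A} {j : Fin k} (s : Equiv.Perm (Fin k))
    (h : TC (fun i => α (s i)) j δ) : TC α (s j) δ := by
  intro ν p a b hab H
  let E : (Σ i, Fin (ν (s i))) ≃ Σ i, Fin (ν i) :=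
    Equiv.sigmaCongrLeft (β := fun i => Fin (ν i)) s
  have heval : ∀ g : Fin k → Bool,
      evalTup (ν := fun i => ν (s i)) (p.subst fun x => .var (E.symm x))
        (fun i => a (s i)) (fun i => b (s i)) g = evalTup p a b (fun i => g (s.symm i)) := by
    intro g
    simp only [evalTup, Poly.eval_subst]
    congr 1
    funext x
    obtain ⟨⟨i, m⟩, rfl⟩ := E.surjective x
    have hE : E ⟨i, m⟩ = ⟨s i, m⟩ := rfl
    rw [Equiv.symm_apply_apply, hE]
    simp [Poly.eval]
  have hupd : ∀ (g : Fin k → Bool) (c : Bool),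
      (fun i => Function.update g j c (s.symm i)) =
        Function.update (fun i => g (s.symm i)) (s j) c := by
    intro g c
    funext i
    simp [Function.update_apply, Equiv.symm_apply_eq]
  have key := h (fun i => ν (s i)) (p.subst fun x => .var (E.symm x))
    (fun i => a (s i)) (fun i => b (s i)) (fun i m => hab (s i) m) ?_
  · simpa only [heval, hupd] using key
  · intro g hgj ⟨i, hij, hgi⟩
    rw [heval, heval, hupd]
    exact H _ (by simpa using hgj) ⟨s i, by simpa using hij, by simpa using hgi⟩

theorem TC_comp_iff {σ : Signature} {A : Alg σ} {k : ℕ} {α : Fin k → Congruence A}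
    {δ : Congruence A} {j : Fin k} (s : Equiv.Perm (Fin k)) :
    TC (fun i => α (s i)) j δ ↔ TC α (s j) δ := by
  refine ⟨TC.of_comp s, fun h => ?_⟩
  have h' := TC.of_comp (α := fun i => α (s i)) (j := s j) (δ := δ) s.symm (by simpa using h)
  simpa using h'

theorem commutator_symmetric {σ : Signature} (A : Alg σ) (n : ℕ) (D : DayOps A n)
    (k : ℕ) (hk : 2 ≤ k) (α : Fin k → Congruence A) (s : Equiv.Perm (Fin k)) :
    commTC α ⟨k-1, by omega⟩ = commTC (fun i => α (s i)) ⟨k-1, by omega⟩ := by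
  have h : TC α ⟨k-1, by omega⟩ = TC (fun i => α (s i)) ⟨k-1, by omega⟩ := by
    funext δ
    rw [eq_iff_iff, TC_comp_iff]
    exact ⟨fun h => h.change_coordinate D _, fun h => h.change_coordinate D _⟩
  unfold commTC
  rw [h]

end UACommutator
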